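/- arXiv:1606.06825 — 2 statements merged into one kernel-verified Lean document; each statement's English description precedes it below -/
import Mathlib

section
/- Let n ≥ 2 be an integer, p ∈ (1,2), K ⊂ ℝⁿ a compact set, and M > 0. Then there exists a constant c₀ = c₀(n,p,K,M) with the following property: for every measurable ρ : ℝⁿ → [0,∞) with ∫_{ℝⁿ} ρ dx ≤ M, every s ∈ (0,1], and every smooth function u : ℝⁿ → ℝ with compact support contained in K, one has ∫_K |u(x)|² ρ(x) dx ≤ c₀ ( ω_p(s)^{2(p-1)/p} ‖∇u‖²_{L^p(K)} + (1+s^{-2n})² ( ‖u‖_{L^p(K)}^{2p} + ‖u‖_{L^1(K)}^{2/p} ) ), where ω_p(s) = sup_{x∈K} ∫_{|x-y|≤s} |x-y|^{(p-n)/(p-1)} ρ(y) dy. -/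
open MeasureTheory Metric Set Filter Topology

section helpers

open scoped ENNReal

lemma lintegral_comp_smul_of_pos {n : ℕ} {g : EuclideanSpace ℝ (Fin n) → ℝ≥0∞}
    (hg : Measurable g) {t : ℝ} (ht : 0 < t) :
    ∫⁻ z, g (t • z) = ENNReal.ofReal ((t ^ n)⁻¹) * ∫⁻ z, g z := by
  have h := Measure.map_addHaar_smul (volume : Measure (EuclideanSpace ℝ (Fin n))) ht.ne'
  rw [← lintegral_map hg (measurable_const_smul t), h, lintegral_smul_measure,
    finrank_euclideanSpace_fin, abs_of_pos (by positivity), smul_eq_mul]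

lemma setLIntegral_norm_rpow_scale {n : ℕ} {A : Set (EuclideanSpace ℝ (Fin n))}
    (hA : MeasurableSet A) (γ : ℝ) {r : ℝ} (hr : 0 < r) :
    ∫⁻ w in (fun w => r⁻¹ • w) ⁻¹' A, ENNReal.ofReal (‖w‖ ^ γ) =
      ENNReal.ofReal (r ^ (n + γ)) * ∫⁻ w in A, ENNReal.ofReal (‖w‖ ^ γ) := by
  have hm : Measurable (fun w : EuclideanSpace ℝ (Fin n) => ENNReal.ofReal (‖w‖ ^ γ)) := by
    fun_prop
  have hA' : MeasurableSet ((fun w : EuclideanSpace ℝ (Fin n) => r⁻¹ • w) ⁻¹' A) :=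
    measurable_const_smul _ hA
  have h := lintegral_comp_smul_of_pos (hm.indicator hA) (inv_pos.2 hr)
  rw [← lintegral_indicator hA, ← lintegral_indicator hA']
  have e : ∀ w, ((fun w : EuclideanSpace ℝ (Fin n) => r⁻¹ • w) ⁻¹' A).indicator
      (fun w => ENNReal.ofReal (‖w‖ ^ γ)) w = ENNReal.ofReal (r ^ γ) *
      A.indicator (fun w => ENNReal.ofReal (‖w‖ ^ γ)) (r⁻¹ • w) := by
    intro w
    by_cases hw : r⁻¹ • w ∈ A
    · rw [indicator_of_mem (by exact hw), indicator_of_mem hw,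
        ← ENNReal.ofReal_mul (by positivity), norm_smul, ← Real.mul_rpow hr.le (by positivity),
        Real.norm_of_nonneg (by positivity), mul_inv_cancel_left₀ hr.ne']
    · rw [indicator_of_notMem (by exact hw), indicator_of_notMem hw, mul_zero]
  simp_rw [e]
  rw [lintegral_const_mul' _ _ ENNReal.ofReal_ne_top, h, ← mul_assoc,
    ← ENNReal.ofReal_mul (by positivity), inv_pow, inv_inv, ← Real.rpow_natCast,
    ← Real.rpow_add hr, add_comm γ]

lemma exists_setLIntegral_ball_norm_rpow_le {n : ℕ} (hn : 1 ≤ n) {γ : ℝ} (hγ : -(n : ℝ) < γ) :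
    ∃ C : ℝ, 0 < C ∧ ∀ r : ℝ, 0 < r →
      ∫⁻ w in ball (0 : EuclideanSpace ℝ (Fin n)) r, ENNReal.ofReal (‖w‖ ^ γ) ≤
        ENNReal.ofReal (C * r ^ (n + γ)) := by
  have hfin : ∫⁻ w in ball (0 : EuclideanSpace ℝ (Fin n)) 1, ENNReal.ofReal (‖w‖ ^ γ) < ∞ := by
    have h := integrableOn_ball_of_norm_le_rpow
      (μ := (volume : Measure (EuclideanSpace ℝ (Fin n)))) (f := fun w => ‖w‖ ^ γ) (C := 1)
      (α := -γ) (r := 1) (by simpa using hn) (by simpa using by linarith)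
      (.of_forall fun w => by
        simp [abs_of_nonneg (Real.rpow_nonneg (norm_nonneg w) γ)])
      (by fun_prop : Measurable _).aestronglyMeasurable
    exact h.lintegral_lt_top
  refine ⟨(∫⁻ w in ball (0 : EuclideanSpace ℝ (Fin n)) 1, ENNReal.ofReal (‖w‖ ^ γ)).toReal + 1,
    by positivity, fun r hr => ?_⟩
  have h := setLIntegral_norm_rpow_scale (n := n) (A := ball 0 1) measurableSet_ball γ hr
  have e : (fun w : EuclideanSpace ℝ (Fin n) => r⁻¹ • w) ⁻¹' ball 0 1 = ball 0 r := by
    ext w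
    simp [norm_smul, abs_of_pos hr, inv_mul_lt_iff₀ hr]
  rw [e] at h
  rw [h, mul_comm, ENNReal.ofReal_mul (by positivity)]
  gcongr
  refine (ENNReal.ofReal_toReal hfin.ne).symm.trans_le (ENNReal.ofReal_le_ofReal (by linarith))

lemma exists_setLIntegral_compl_ball_norm_rpow_le {n : ℕ} {γ : ℝ} (hγ : γ < -(n : ℝ)) :
    ∃ C : ℝ, 0 < C ∧ ∀ r : ℝ, 0 < r →
      ∫⁻ w in (ball (0 : EuclideanSpace ℝ (Fin n)) r)ᶜ, ENNReal.ofReal (‖w‖ ^ γ) ≤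
        ENNReal.ofReal (C * r ^ (n + γ)) := by
  have hn : (0 : ℝ) ≤ n := n.cast_nonneg
  have hfin : ∫⁻ w in (ball (0 : EuclideanSpace ℝ (Fin n)) 1)ᶜ,
      ENNReal.ofReal (‖w‖ ^ γ) < ∞ := by
    have hi : Integrable (fun w : EuclideanSpace ℝ (Fin n) =>
        (2 : ℝ) ^ (-γ) * (1 + ‖w‖) ^ (-(-γ))) :=
      (integrable_one_add_norm (by simpa using by linarith)).const_mul _
    refine lt_of_le_of_lt ?_ hi.lintegral_lt_top
    refine (setLIntegral_mono (g := fun w => ENNReal.ofReal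
      ((2 : ℝ) ^ (-γ) * (1 + ‖w‖) ^ (-(-γ)))) (by fun_prop) fun w hw => ?_).trans
      (setLIntegral_le_lintegral _ _)
    have hw1 : 1 ≤ ‖w‖ := by simpa using hw
    refine ENNReal.ofReal_le_ofReal ?_
    rw [neg_neg, Real.rpow_neg (by norm_num), ← Real.inv_rpow (by norm_num),
      ← Real.mul_rpow (by norm_num) (by positivity)]
    exact Real.rpow_le_rpow_of_nonpos (by positivity) (by linarith) (by linarith)
  refine ⟨(∫⁻ w in (ball (0 : EuclideanSpace ℝ (Fin n)) 1)ᶜ,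
    ENNReal.ofReal (‖w‖ ^ γ)).toReal + 1, by positivity, fun r hr => ?_⟩
  have h := setLIntegral_norm_rpow_scale (n := n) (A := (ball 0 1)ᶜ)
    measurableSet_ball.compl γ hr
  have e : (fun w : EuclideanSpace ℝ (Fin n) => r⁻¹ • w) ⁻¹' (ball 0 1)ᶜ = (ball 0 r)ᶜ := by
    ext w
    simp [norm_smul, abs_of_pos hr, le_inv_mul_iff₀ hr]
  rw [e] at h
  rw [h, mul_comm, ENNReal.ofReal_mul (by positivity)]
  gcongr
  refine (ENNReal.ofReal_toReal hfin.ne).symm.trans_le (ENNReal.ofReal_le_ofReal (by linarith))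

lemma enorm_le_add_lintegral_fderiv_segment {n : ℕ} {u : EuclideanSpace ℝ (Fin n) → ℝ}
    (hu : ContDiff ℝ 1 u) (x z : EuclideanSpace ℝ (Fin n)) :
    ‖u x‖ₑ ≤ ‖u (x + z)‖ₑ + ∫⁻ t in Ioc (0 : ℝ) 1, ‖fderiv ℝ u (x + t • z)‖ₑ * ‖z‖ₑ := by
  have hc : ContDiff ℝ 1 (fun t : ℝ => u (x + t • z)) := by fun_prop
  have h := enorm_sub_le_lintegral_deriv_of_contDiffOn_Icc hc.contDiffOn (zero_le_one' ℝ)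
  simp only [one_smul, zero_smul, add_zero] at h
  rw [restrict_Ioc_eq_restrict_Icc]
  have h1 : ‖u x‖ₑ ≤ ‖u (x + z)‖ₑ + ‖u (x + z) - u x‖ₑ := by
    have := enorm_sub_le (a := u (x + z)) (b := u (x + z) - u x)
    simpa using this
  refine h1.trans (add_le_add_right (h.trans (lintegral_mono fun t => ?_)) _)
  have hd : HasDerivAt (fun t : ℝ => u (x + t • z)) (fderiv ℝ u (x + t • z) z) t := by
    have h2 : HasDerivAt (fun t : ℝ => x + t • z) z t := by
      simpa using ((hasDerivAt_id t).smul_const z).const_add x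
    exact ((hu.differentiable one_ne_zero) _).hasFDerivAt.comp_hasDerivAt t h2
  rw [hd.deriv]
  exact ContinuousLinearMap.le_opENorm _ _

lemma lintegral_Ioi_rpow_neg_le {n : ℕ} (hn : 1 ≤ n) {a : ℝ} (ha : 0 < a) :
    ∫⁻ t in Ioi a, ENNReal.ofReal (t⁻¹ * (t ^ n)⁻¹) ≤ ENNReal.ofReal ((a ^ n)⁻¹) := by
  have hn' : (1 : ℝ) ≤ n := by exact_mod_cast hn
  have e : ∀ t ∈ Ioi a, ENNReal.ofReal (t⁻¹ * (t ^ n)⁻¹) =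
      ENNReal.ofReal (t ^ (-(n : ℝ) - 1)) := by
    intro t ht
    have ht0 : 0 < t := ha.trans ht
    rw [Real.rpow_sub_one ht0.ne', Real.rpow_neg ht0.le, Real.rpow_natCast, div_eq_mul_inv,
      mul_comm]
  rw [setLIntegral_congr_fun measurableSet_Ioi e,
    ← ofReal_integral_eq_lintegral_ofReal (integrableOn_Ioi_rpow_of_lt (by linarith) ha)
      ((ae_restrict_mem measurableSet_Ioi).mono fun t ht =>
        Real.rpow_nonneg (ha.trans ht).le _),
    integral_Ioi_rpow_of_lt (by linarith) ha]
  refine ENNReal.ofReal_le_ofReal ?_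
  rw [sub_add_cancel, neg_div_neg_eq, Real.rpow_neg ha.le, Real.rpow_natCast]
  exact div_le_self (by positivity) hn'

lemma measure_ball_mul_enorm_le {n : ℕ} (hn : 1 ≤ n) {u : EuclideanSpace ℝ (Fin n) → ℝ}
    (hu : ContDiff ℝ 1 u) (x : EuclideanSpace ℝ (Fin n)) {s : ℝ} (hs : 0 < s) :
    volume (ball (0 : EuclideanSpace ℝ (Fin n)) s) * ‖u x‖ₑ ≤ (∫⁻ y, ‖u y‖ₑ) +
      ENNReal.ofReal (s ^ n) * ∫⁻ w in ball (0 : EuclideanSpace ℝ (Fin n)) s,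
        ENNReal.ofReal (‖w‖ ^ (1 - n : ℝ)) * ‖fderiv ℝ u (x + w)‖ₑ := by
  have hdc : Continuous (fderiv ℝ u) := hu.continuous_fderiv one_ne_zero
  set Φ : EuclideanSpace ℝ (Fin n) → ℝ≥0∞ := fun w => ‖fderiv ℝ u (x + w)‖ₑ * ‖w‖ₑ with hΦ
  have hΦm : Measurable Φ := by
    have : Measurable fun w => fderiv ℝ u (x + w) := (by fun_prop : Continuous _).measurable
    exact this.enorm.mul measurable_id.enorm
  have h1 : volume (ball (0 : EuclideanSpace ℝ (Fin n)) s) * ‖u x‖ₑ ≤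
      (∫⁻ z in ball (0 : EuclideanSpace ℝ (Fin n)) s, ‖u (x + z)‖ₑ) +
      ∫⁻ z in ball (0 : EuclideanSpace ℝ (Fin n)) s, ∫⁻ t in Ioc (0 : ℝ) 1,
        ‖fderiv ℝ u (x + t • z)‖ₑ * ‖z‖ₑ := by
    rw [mul_comm, ← setLIntegral_const, ← lintegral_add_left]
    · exact lintegral_mono fun z => enorm_le_add_lintegral_fderiv_segment hu x z
    · exact (by fun_prop : Continuous fun z => u (x + z)).measurable.enorm
  have h2 : (∫⁻ z in ball (0 : EuclideanSpace ℝ (Fin n)) s, ‖u (x + z)‖ₑ) ≤ ∫⁻ y, ‖u y‖ₑ :=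
    (setLIntegral_le_lintegral _ _).trans_eq (lintegral_add_left_eq_self (fun y => ‖u y‖ₑ) x)
  have h3 : ∫⁻ z in ball (0 : EuclideanSpace ℝ (Fin n)) s, ∫⁻ t in Ioc (0 : ℝ) 1,
        ‖fderiv ℝ u (x + t • z)‖ₑ * ‖z‖ₑ =
      ∫⁻ t in Ioc (0 : ℝ) 1, ∫⁻ z in ball (0 : EuclideanSpace ℝ (Fin n)) s,
        ‖fderiv ℝ u (x + t • z)‖ₑ * ‖z‖ₑ := by
    refine lintegral_lintegral_swap (Measurable.aemeasurable ?_)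
    have : Measurable fun q : EuclideanSpace ℝ (Fin n) × ℝ => fderiv ℝ u (x + q.2 • q.1) :=
      (by fun_prop : Continuous _).measurable
    exact this.enorm.mul measurable_fst.enorm
  have h4 : ∀ t ∈ Ioc (0 : ℝ) 1, ∫⁻ z in ball (0 : EuclideanSpace ℝ (Fin n)) s,
        ‖fderiv ℝ u (x + t • z)‖ₑ * ‖z‖ₑ =
      ∫⁻ w, ENNReal.ofReal (t⁻¹ * (t ^ n)⁻¹) * (ball 0 (t * s)).indicator Φ w := by
    intro t ht
    have ht0 : 0 < t := ht.1
    have hi := lintegral_comp_smul_of_pos (hΦm.indicator (measurableSet_ball (x := 0)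
      (ε := t * s))) ht0
    rw [lintegral_const_mul' _ _ ENNReal.ofReal_ne_top, ENNReal.ofReal_mul (by positivity),
      mul_assoc, ← hi, ← lintegral_const_mul' _ _ ENNReal.ofReal_ne_top,
      ← lintegral_indicator measurableSet_ball]
    congr 1
    ext z
    have hm : t • z ∈ ball (0 : EuclideanSpace ℝ (Fin n)) (t * s) ↔ z ∈ ball 0 s := by
      simp [norm_smul, abs_of_pos ht0, ht0]
    by_cases hz : z ∈ ball (0 : EuclideanSpace ℝ (Fin n)) s
    · rw [indicator_of_mem hz, indicator_of_mem (hm.2 hz), hΦ]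
      simp only [enorm_smul]
      rw [Real.enorm_of_nonneg ht0.le, mul_left_comm, ← mul_assoc (ENNReal.ofReal t⁻¹),
        ← ENNReal.ofReal_mul (by positivity), inv_mul_cancel₀ ht0.ne', ENNReal.ofReal_one,
        one_mul]
    · rw [indicator_of_notMem hz, indicator_of_notMem (by rwa [hm]), mul_zero]
  have hset : MeasurableSet {q : ℝ × EuclideanSpace ℝ (Fin n) | ‖q.2‖ < q.1 * s} :=
    (isOpen_lt (by fun_prop) (by fun_prop)).measurableSet
  have h5 : ∫⁻ t in Ioc (0 : ℝ) 1, ∫⁻ w, ENNReal.ofReal (t⁻¹ * (t ^ n)⁻¹) *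
        (ball 0 (t * s)).indicator Φ w =
      ∫⁻ w, ∫⁻ t in Ioc (0 : ℝ) 1, ENNReal.ofReal (t⁻¹ * (t ^ n)⁻¹) *
        (ball 0 (t * s)).indicator Φ w := by
    refine lintegral_lintegral_swap (Measurable.aemeasurable ?_)
    have e : Function.uncurry (fun (t : ℝ) (w : EuclideanSpace ℝ (Fin n)) =>
        ENNReal.ofReal (t⁻¹ * (t ^ n)⁻¹) * (ball 0 (t * s)).indicator Φ w) =
        fun q => ENNReal.ofReal (q.1⁻¹ * (q.1 ^ n)⁻¹) *
        {q : ℝ × EuclideanSpace ℝ (Fin n) | ‖q.2‖ < q.1 * s}.indicator (fun q => Φ q.2) q := by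
      ext ⟨t, w⟩
      simp [indicator]
    rw [e]
    exact (by fun_prop : Measurable _).mul ((hΦm.comp measurable_snd).indicator hset)
  have h6 : ∀ w, ∫⁻ t in Ioc (0 : ℝ) 1, ENNReal.ofReal (t⁻¹ * (t ^ n)⁻¹) *
        (ball 0 (t * s)).indicator Φ w ≤
      ENNReal.ofReal (s ^ n) * (ball (0 : EuclideanSpace ℝ (Fin n)) s).indicator (fun w =>
        ENNReal.ofReal (‖w‖ ^ (1 - n : ℝ)) * ‖fderiv ℝ u (x + w)‖ₑ) w := by
    intro w
    by_cases hw : w ∈ ball (0 : EuclideanSpace ℝ (Fin n)) s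
    · rcases eq_or_ne w 0 with rfl | hw0
      · have : ∀ t : ℝ, (ball 0 (t * s)).indicator Φ 0 = 0 := fun t => by simp [indicator, hΦ]
        simp [this]
      have hwp : 0 < ‖w‖ := norm_pos_iff.2 hw0
      have ha : 0 < ‖w‖ / s := by positivity
      calc ∫⁻ t in Ioc (0 : ℝ) 1, ENNReal.ofReal (t⁻¹ * (t ^ n)⁻¹) *
            (ball 0 (t * s)).indicator Φ w
          ≤ ∫⁻ t, (Ioi (‖w‖ / s)).indicator
              (fun t => ENNReal.ofReal (t⁻¹ * (t ^ n)⁻¹)) t * Φ w := by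
            refine (setLIntegral_le_lintegral _ _).trans (lintegral_mono fun t => ?_)
            by_cases ht : w ∈ ball (0 : EuclideanSpace ℝ (Fin n)) (t * s)
            · have : t ∈ Ioi (‖w‖ / s) := by
                rw [mem_Ioi, div_lt_iff₀ hs]
                simpa using ht
              rw [indicator_of_mem ht, indicator_of_mem this]
            · rw [indicator_of_notMem ht, mul_zero]
              exact zero_le
        _ = (∫⁻ t in Ioi (‖w‖ / s), ENNReal.ofReal (t⁻¹ * (t ^ n)⁻¹)) * Φ w := by
            rw [lintegral_mul_const, lintegral_indicator measurableSet_Ioi]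
            exact Measurable.indicator (by fun_prop) measurableSet_Ioi
        _ ≤ ENNReal.ofReal (((‖w‖ / s) ^ n)⁻¹) * Φ w := by
            gcongr
            exact lintegral_Ioi_rpow_neg_le hn ha
        _ = _ := by
            rw [indicator_of_mem hw, hΦ]
            simp only
            rw [← ofReal_norm w, mul_left_comm, ← ENNReal.ofReal_mul (by positivity),
              ← mul_assoc, ← ENNReal.ofReal_mul (by positivity), mul_comm]
            congr 2
            rw [Real.rpow_sub hwp, Real.rpow_one, Real.rpow_natCast, div_pow]
            field_simp
    · rw [indicator_of_notMem hw, mul_zero, nonpos_iff_eq_zero,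
        setLIntegral_eq_zero_iff measurableSet_Ioc]
      · refine .of_forall fun t ht => ?_
        rw [indicator_of_notMem, mul_zero]
        intro h
        rw [mem_ball_zero_iff] at h hw
        nlinarith [ht.2]
      · have : (fun t : ℝ => (ball 0 (t * s)).indicator Φ w) =
            {t : ℝ | ‖w‖ < t * s}.indicator fun _ => Φ w := by
          ext t
          simp [indicator]
        refine (by fun_prop : Measurable _).mul ?_
        rw [this]
        exact measurable_const.indicator (isOpen_lt (by fun_prop) (by fun_prop)).measurableSet
  refine h1.trans (add_le_add h2 ?_)
  rw [h3, setLIntegral_congr_fun measurableSet_Ioc h4, h5, ← lintegral_indicator measurableSet_ball,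
    ← lintegral_const_mul' _ _ ENNReal.ofReal_ne_top]
  exact lintegral_mono h6

lemma exists_enorm_le_riesz {n : ℕ} (hn : 1 ≤ n) :
    ∃ C : ℝ, 0 < C ∧ ∀ u : EuclideanSpace ℝ (Fin n) → ℝ, ContDiff ℝ 1 u →
      ∀ (x : EuclideanSpace ℝ (Fin n)) (s : ℝ), 0 < s →
      ‖u x‖ₑ ≤ ENNReal.ofReal C * (ENNReal.ofReal ((s ^ n)⁻¹) * (∫⁻ y, ‖u y‖ₑ) +
        ∫⁻ w in ball (0 : EuclideanSpace ℝ (Fin n)) s,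
        ENNReal.ofReal (‖w‖ ^ (1 - n : ℝ)) * ‖fderiv ℝ u (x + w)‖ₑ) := by
  have hv0 : volume (ball (0 : EuclideanSpace ℝ (Fin n)) 1) ≠ 0 :=
    (measure_ball_pos _ _ one_pos).ne'
  have hvt : volume (ball (0 : EuclideanSpace ℝ (Fin n)) 1) ≠ ∞ := measure_ball_lt_top.ne
  refine ⟨(volume (ball (0 : EuclideanSpace ℝ (Fin n)) 1)).toReal⁻¹,
    inv_pos.2 (ENNReal.toReal_pos hv0 hvt), fun u hu x s hs => ?_⟩
  have h := measure_ball_mul_enorm_le hn hu x hs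
  rw [Measure.addHaar_ball_of_pos _ _ hs, finrank_euclideanSpace_fin] at h
  have hsn : 0 < s ^ n := by positivity
  have hS0 : ENNReal.ofReal (s ^ n) ≠ 0 := (ENNReal.ofReal_pos.2 hsn).ne'
  rw [ENNReal.ofReal_inv_of_pos (ENNReal.toReal_pos hv0 hvt), ENNReal.ofReal_toReal hvt,
    ENNReal.ofReal_inv_of_pos hsn]
  set V := volume (ball (0 : EuclideanSpace ℝ (Fin n)) 1)
  set S := ENNReal.ofReal (s ^ n)
  calc ‖u x‖ₑ = V⁻¹ * (S⁻¹ * (S * V * ‖u x‖ₑ)) := by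
        rw [mul_assoc, ENNReal.inv_mul_cancel_left hS0 ENNReal.ofReal_ne_top,
          ENNReal.inv_mul_cancel_left hv0 hvt]
    _ ≤ _ := by
        refine mul_le_mul_right ((mul_le_mul_right h _).trans_eq ?_) _
        rw [mul_add, ENNReal.inv_mul_cancel_left hS0 ENNReal.ofReal_ne_top]

lemma lintegral_rpow_mul_rpow_mul_rpow_le {α : Type*} [MeasurableSpace α] {μ : Measure α}
    {f g h : α → ℝ≥0∞} (hf : AEMeasurable f μ) (hg : AEMeasurable g μ) (hh : AEMeasurable h μ)
    {a b c : ℝ} (ha : 0 ≤ a) (hb : 0 ≤ b) (hc : 0 ≤ c) (habc : a + b + c = 1) :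
    ∫⁻ x, f x ^ a * g x ^ b * h x ^ c ∂μ ≤
      (∫⁻ x, f x ∂μ) ^ a * (∫⁻ x, g x ∂μ) ^ b * (∫⁻ x, h x ∂μ) ^ c := by
  have := ENNReal.lintegral_prod_norm_pow_le (μ := μ) Finset.univ (f := ![f, g, h])
    (p := ![a, b, c]) (by
      intro i _
      fin_cases i <;> assumption) (by simpa [Fin.sum_univ_three] using habc) (by
      intro i _
      fin_cases i <;> assumption)
  simpa [Fin.prod_univ_three] using this

lemma setLIntegral_riesz_near_le {n : ℕ} (hn : 2 ≤ n) {p : ℝ} (hp : p ∈ Ioo (1 : ℝ) 2)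
    {f : EuclideanSpace ℝ (Fin n) → ℝ≥0∞} (hf : Measurable f) {A B : Set (EuclideanSpace ℝ (Fin n))}
    {e b : ℝ} (heb : e / 2 + b * (1 - 1 / p) = 1 - n) :
    ∫⁻ w in A ∩ B, ENNReal.ofReal (‖w‖ ^ (1 - n : ℝ)) * f w ≤
      (∫⁻ w, f w ^ p) ^ (1 / p - 1 / 2) *
      (∫⁻ w in A, ENNReal.ofReal (‖w‖ ^ e) * f w ^ p) ^ (1 / 2 : ℝ) *
      (∫⁻ w in B, ENNReal.ofReal (‖w‖ ^ b)) ^ (1 - 1 / p) := by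
  obtain ⟨hp1, hp2⟩ := hp
  have hp0 : 0 < p := by linarith
  have hip : 1 / 2 ≤ 1 / p := one_div_le_one_div_of_le hp0 hp2.le
  have hip1 : 1 / p ≤ 1 := by rw [div_le_one hp0]; exact hp1.le
  have hn' : (2 : ℝ) ≤ n := by exact_mod_cast hn
  have key : ∀ w : EuclideanSpace ℝ (Fin n), ENNReal.ofReal (‖w‖ ^ (1 - n : ℝ)) * f w ≤
      (f w ^ p) ^ (1 / p - 1 / 2) * (ENNReal.ofReal (‖w‖ ^ e) * f w ^ p) ^ (1 / 2 : ℝ) *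
      ENNReal.ofReal (‖w‖ ^ b) ^ (1 - 1 / p) := by
    intro w
    rcases eq_or_ne w 0 with rfl | hw
    · rw [norm_zero, Real.zero_rpow (by linarith), ENNReal.ofReal_zero, zero_mul]
      exact zero_le
    have hwp : 0 < ‖w‖ := norm_pos_iff.2 hw
    refine le_of_eq ?_
    rw [ENNReal.mul_rpow_of_nonneg _ _ (by norm_num), ENNReal.ofReal_rpow_of_pos (by positivity),
      ENNReal.ofReal_rpow_of_pos (by positivity), ← Real.rpow_mul hwp.le, ← Real.rpow_mul hwp.le,
      show (1 - n : ℝ) = e * (1 / 2) + b * (1 - 1 / p) by rw [← heb]; ring, Real.rpow_add hwp,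
      ENNReal.ofReal_mul (by positivity)]
    have hF : (f w ^ p) ^ (1 / p - 1 / 2) * (f w ^ p) ^ (1 / 2 : ℝ) = f w := by
      rw [← ENNReal.rpow_add_of_nonneg _ _ (by linarith) (by norm_num), ← ENNReal.rpow_mul,
        show p * (1 / p - 1 / 2 + 1 / 2) = 1 by field_simp; ring, ENNReal.rpow_one]
    nth_rewrite 1 [← hF]
    ring
  refine (lintegral_mono key).trans ((lintegral_rpow_mul_rpow_mul_rpow_le
    (by fun_prop) (by fun_prop) (by fun_prop) (by linarith) (by norm_num) (by linarith)
    (by ring)).trans ?_)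
  gcongr
  · exact Measure.restrict_le_self
  · exact inter_subset_left
  · exact inter_subset_right

lemma setLIntegral_riesz_far_le {n : ℕ} {p : ℝ} (hp : 1 < p)
    {f : EuclideanSpace ℝ (Fin n) → ℝ≥0∞} (hf : Measurable f) {B : Set (EuclideanSpace ℝ (Fin n))}
    {c : ℝ} (hc : c * (1 - 1 / p) = 1 - n) :
    ∫⁻ w in B, ENNReal.ofReal (‖w‖ ^ (1 - n : ℝ)) * f w ≤
      (∫⁻ w, f w ^ p) ^ (1 / p) * (∫⁻ w in B, ENNReal.ofReal (‖w‖ ^ c)) ^ (1 - 1 / p) := by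
  have hp0 : 0 < p := by linarith
  have hip1 : 1 / p ≤ 1 := by rw [div_le_one hp0]; exact hp.le
  have key : ∀ w : EuclideanSpace ℝ (Fin n), ENNReal.ofReal (‖w‖ ^ (1 - n : ℝ)) * f w =
      (f w ^ p) ^ (1 / p) * ENNReal.ofReal (‖w‖ ^ c) ^ (1 - 1 / p) := by
    intro w
    rw [ENNReal.ofReal_rpow_of_nonneg (by positivity) (by linarith),
      ← Real.rpow_mul (norm_nonneg _), hc, ← ENNReal.rpow_mul, mul_one_div_cancel hp0.ne',
      ENNReal.rpow_one, mul_comm]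
  simp_rw [key]
  refine (ENNReal.lintegral_mul_norm_pow_le (by fun_prop) (by fun_prop) (by positivity)
    (by linarith) (by ring)).trans ?_
  gcongr
  exact Measure.restrict_le_self

lemma ennreal_add_sq_le (a b : ℝ≥0∞) : (a + b) ^ 2 ≤ 4 * (a ^ 2 + b ^ 2) := by
  have h : a + b ≤ 2 * max a b := by
    rw [two_mul]; exact add_le_add (le_max_left _ _) (le_max_right _ _)
  calc (a + b) ^ 2 ≤ (2 * max a b) ^ 2 := by gcongr
    _ = 4 * max a b ^ 2 := by rw [mul_pow]; norm_num
    _ ≤ 4 * (a ^ 2 + b ^ 2) := by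
        gcongr
        rcases max_choice a b with h | h <;> rw [h]
        · exact le_self_add
        · exact le_add_self

lemma setLIntegral_potential_mul_le {n : ℕ} {g ρ : EuclideanSpace ℝ (Fin n) → ℝ≥0∞}
    (hg : Measurable g) (hρ : Measurable ρ) {K : Set (EuclideanSpace ℝ (Fin n))}
    (hgK : ∀ y, y ∉ K → g y = 0) {e s : ℝ} {w : ℝ≥0∞}
    (hw : ∀ y ∈ K, ∫⁻ x in closedBall y s, ENNReal.ofReal (dist y x ^ e) * ρ x ≤ w) :
    ∫⁻ x in K, (∫⁻ z in ball (0 : EuclideanSpace ℝ (Fin n)) s,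
      ENNReal.ofReal (‖z‖ ^ e) * g (x + z)) * ρ x ≤ w * ∫⁻ y, g y := by
  have h1 : ∀ x, (∫⁻ z in ball (0 : EuclideanSpace ℝ (Fin n)) s,
      ENNReal.ofReal (‖z‖ ^ e) * g (x + z)) * ρ x =
      ∫⁻ y, (ball (0 : EuclideanSpace ℝ (Fin n)) s).indicator
        (fun z => ENNReal.ofReal (‖z‖ ^ e)) (y - x) * g y * ρ x := by
    intro x
    rw [lintegral_mul_const, ← lintegral_indicator measurableSet_ball]
    · congr 1
      rw [← lintegral_sub_right_eq_self _ x]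
      congr 1
      ext y
      by_cases h : y - x ∈ ball (0 : EuclideanSpace ℝ (Fin n)) s
      · rw [indicator_of_mem h, indicator_of_mem h, add_sub_cancel]
      · rw [indicator_of_notMem h, indicator_of_notMem h, zero_mul]
    · refine Measurable.mul (Measurable.comp (g := (ball (0 : EuclideanSpace ℝ (Fin n)) s).indicator
        (fun z => ENNReal.ofReal (‖z‖ ^ e))) ?_ (by fun_prop)) hg
      exact Measurable.indicator (by fun_prop) measurableSet_ball
  have hk : Measurable ((ball (0 : EuclideanSpace ℝ (Fin n)) s).indicator
        (fun z => ENNReal.ofReal (‖z‖ ^ e))) :=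
    Measurable.indicator (by fun_prop) measurableSet_ball
  simp_rw [h1]
  rw [lintegral_lintegral_swap (Measurable.aemeasurable ?_), ← lintegral_const_mul _ hg]
  · refine lintegral_mono fun y => ?_
    by_cases hy : y ∈ K
    · calc ∫⁻ x in K, (ball (0 : EuclideanSpace ℝ (Fin n)) s).indicator
            (fun z => ENNReal.ofReal (‖z‖ ^ e)) (y - x) * g y * ρ x
          ≤ ∫⁻ x, g y * (closedBall y s).indicator
            (fun x => ENNReal.ofReal (dist y x ^ e) * ρ x) x := by
            refine (setLIntegral_le_lintegral _ _).trans (lintegral_mono fun x => ?_)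
            by_cases h : y - x ∈ ball (0 : EuclideanSpace ℝ (Fin n)) s
            · have h' : x ∈ closedBall y s := by
                rw [mem_closedBall, dist_comm, dist_eq_norm]
                exact (mem_ball_zero_iff.1 h).le
              rw [indicator_of_mem h, indicator_of_mem h', dist_eq_norm]
              exact le_of_eq (by ring)
            · rw [indicator_of_notMem h, zero_mul, zero_mul]
              exact zero_le
        _ = g y * ∫⁻ x in closedBall y s, ENNReal.ofReal (dist y x ^ e) * ρ x := by
            rw [lintegral_const_mul, lintegral_indicator measurableSet_closedBall]
            exact Measurable.indicator (by fun_prop) measurableSet_closedBall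
        _ ≤ w * g y := by
            rw [mul_comm]
            gcongr
            exact hw y hy
    · simp [hgK y hy]
  · exact ((hk.comp (by fun_prop : Measurable fun q : EuclideanSpace ℝ (Fin n) ×
      EuclideanSpace ℝ (Fin n) => q.2 - q.1)).mul (hg.comp measurable_snd)).mul
      (hρ.comp measurable_fst)

lemma exists_setLIntegral_sq_mul_le {n : ℕ} (hn : 2 ≤ n) {p : ℝ} (hp : p ∈ Ioo (1 : ℝ) 2) :
    ∃ C : ℝ, 0 < C ∧ ∀ u : EuclideanSpace ℝ (Fin n) → ℝ, ContDiff ℝ 1 u →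
      ∀ K : Set (EuclideanSpace ℝ (Fin n)), (∀ y, y ∉ K → fderiv ℝ u y = 0) →
      (∫⁻ y, ‖fderiv ℝ u y‖ₑ ^ p) ≠ ∞ →
      ∀ ρ : EuclideanSpace ℝ (Fin n) → ℝ≥0∞, Measurable ρ →
      ∀ (s r : ℝ) (w : ℝ≥0∞), 0 < s → 0 < r →
      (∀ y ∈ K, ∫⁻ x in closedBall y s,
        ENNReal.ofReal (dist y x ^ ((p - n) / (p - 1))) * ρ x ≤ w) →
      ∫⁻ x in K, ‖u x‖ₑ ^ 2 * ρ x ≤ ENNReal.ofReal C *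
        ((ENNReal.ofReal ((s ^ n)⁻¹) * ∫⁻ y, ‖u y‖ₑ) ^ 2 * (∫⁻ y, ρ y) +
        (∫⁻ y, ‖fderiv ℝ u y‖ₑ ^ p) ^ (2 / p) *
          (ENNReal.ofReal ((r ^ ((p - n) / (p - 1))) ^ ((p - 2) / p)) * w +
          ENNReal.ofReal ((r ^ ((p - n) / (p - 1))) ^ (2 * (p - 1) / p)) * (∫⁻ y, ρ y))) := by
  have hp1 : 1 < p := hp.1
  have hp2 : p < 2 := hp.2
  have hp0 : 0 < p := by linarith
  have hp10 : 0 < p - 1 := by linarith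
  have hn' : (2 : ℝ) ≤ n := by exact_mod_cast hn
  have hip1 : 1 / p ≤ 1 := by rw [div_le_one hp0]; exact hp1.le
  set e : ℝ := (p - n) / (p - 1) with he
  have he0 : e < 0 := div_neg_of_neg_of_pos (by linarith) hp10
  set b : ℝ := (1 - n - e / 2) * (p / (p - 1)) with hb
  set c : ℝ := (1 - n) * (p / (p - 1)) with hc
  have hnb : n + b = e * ((p - 2) / (2 * (p - 1))) := by
    rw [hb, he]; field_simp; ring
  have hnc : n + c = e := by
    rw [hc, he]; field_simp; ring
  have hbn : -(n : ℝ) < b := by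
    have : 0 < n + b := by
      rw [hnb]
      exact mul_pos_of_neg_of_neg he0 (div_neg_of_neg_of_pos (by linarith) (by linarith))
    linarith
  have hcn : c < -(n : ℝ) := by linarith
  have hbeq : e / 2 + b * (1 - 1 / p) = 1 - n := by
    rw [hb]; field_simp; ring
  have hceq : c * (1 - 1 / p) = 1 - n := by
    rw [hc]; field_simp
  obtain ⟨C₀, hC₀, h0⟩ := exists_enorm_le_riesz (n := n) (by omega)
  obtain ⟨C₁, hC₁, h1⟩ := exists_setLIntegral_ball_norm_rpow_le (n := n) (by omega) hbn
  obtain ⟨C₂, hC₂, h2⟩ := exists_setLIntegral_compl_ball_norm_rpow_le hcn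
  set D₁ := C₁ ^ (2 * (1 - 1 / p))
  set D₂ := C₂ ^ (2 * (1 - 1 / p))
  have hD₁0 : 0 < D₁ := Real.rpow_pos_of_pos hC₁ _
  have hD₂0 : 0 < D₂ := Real.rpow_pos_of_pos hC₂ _
  refine ⟨C₀ ^ 2 * 16 * (1 + D₁ + D₂), by positivity,
    fun u hu K huK hF ρ hρ s r w hs hr hw => ?_⟩
  set F := ∫⁻ y, ‖fderiv ℝ u y‖ₑ ^ p
  set U := ∫⁻ y, ‖u y‖ₑ
  set m := ∫⁻ y, ρ y
  set A := ENNReal.ofReal ((s ^ n)⁻¹) * U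
  set R₁ := ENNReal.ofReal ((r ^ e) ^ ((p - 2) / p)) with hR₁
  set R₂ := ENNReal.ofReal ((r ^ e) ^ (2 * (p - 1) / p)) with hR₂
  set J : EuclideanSpace ℝ (Fin n) → ℝ≥0∞ := fun x =>
    ∫⁻ z in ball (0 : EuclideanSpace ℝ (Fin n)) s,
      ENNReal.ofReal (‖z‖ ^ e) * ‖fderiv ℝ u (x + z)‖ₑ ^ p
  have hdc : Continuous (fderiv ℝ u) := hu.continuous_fderiv one_ne_zero
  have hr1 : ENNReal.ofReal (C₁ * r ^ (n + b)) ^ (2 * (1 - 1 / p)) = ENNReal.ofReal D₁ * R₁ := by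
    rw [ENNReal.ofReal_rpow_of_pos (by positivity), Real.mul_rpow hC₁.le (by positivity),
      ENNReal.ofReal_mul hD₁0.le, hR₁, ← Real.rpow_mul hr.le, ← Real.rpow_mul hr.le, hnb]
    congr 3
    field_simp
  have hr2 : ENNReal.ofReal (C₂ * r ^ (n + c)) ^ (2 * (1 - 1 / p)) = ENNReal.ofReal D₂ * R₂ := by
    rw [ENNReal.ofReal_rpow_of_pos (by positivity), Real.mul_rpow hC₂.le (by positivity),
      ENNReal.ofReal_mul hD₂0.le, hR₂, hnc]
    congr 3
    field_simp
  have hpt : ∀ x, ‖u x‖ₑ ^ 2 ≤ ENNReal.ofReal (C₀ ^ 2 * 16) * (A ^ 2 +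
      F ^ (2 / p) * (ENNReal.ofReal D₂ * R₂) + F ^ (2 / p - 1) * (ENNReal.ofReal D₁ * R₁) * J x) := by
    intro x
    have hfm : Measurable fun z => ‖fderiv ℝ u (x + z)‖ₑ :=
      (by fun_prop : Continuous fun z => fderiv ℝ u (x + z)).measurable.enorm
    have hFx : ∫⁻ z, ‖fderiv ℝ u (x + z)‖ₑ ^ p = F :=
      lintegral_add_left_eq_self (fun y => ‖fderiv ℝ u y‖ₑ ^ p) x
    set S := ∫⁻ z in ball (0 : EuclideanSpace ℝ (Fin n)) s ∩ ball 0 r,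
      ENNReal.ofReal (‖z‖ ^ (1 - n : ℝ)) * ‖fderiv ℝ u (x + z)‖ₑ
    set L := ∫⁻ z in (ball (0 : EuclideanSpace ℝ (Fin n)) r)ᶜ,
      ENNReal.ofReal (‖z‖ ^ (1 - n : ℝ)) * ‖fderiv ℝ u (x + z)‖ₑ
    have hS : S ^ 2 ≤ F ^ (2 / p - 1) * (ENNReal.ofReal D₁ * R₁) * J x := by
      have hS1 : S ≤ F ^ (1 / p - 1 / 2) * J x ^ (1 / 2 : ℝ) *
          ENNReal.ofReal (C₁ * r ^ (n + b)) ^ (1 - 1 / p) := by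
        refine (setLIntegral_riesz_near_le hn hp hfm hbeq).trans ?_
        rw [hFx]
        gcongr
        exact h1 r hr
      calc S ^ 2 ≤ (F ^ (1 / p - 1 / 2) * J x ^ (1 / 2 : ℝ) *
          ENNReal.ofReal (C₁ * r ^ (n + b)) ^ (1 - 1 / p)) ^ 2 := by gcongr
        _ = _ := by
          rw [← hr1, mul_pow, mul_pow]
          simp only [← ENNReal.rpow_mul_natCast]
          rw [mul_right_comm, show (1 / 2 : ℝ) * (2 : ℕ) = 1 by norm_num, ENNReal.rpow_one,
            show (1 / p - 1 / 2) * (2 : ℕ) = 2 / p - 1 by push_cast; ring,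
            show (1 - 1 / p) * (2 : ℕ) = 2 * (1 - 1 / p) by push_cast; ring]
    have hL : L ^ 2 ≤ F ^ (2 / p) * (ENNReal.ofReal D₂ * R₂) := by
      have hL1 : L ≤ F ^ (1 / p) * ENNReal.ofReal (C₂ * r ^ (n + c)) ^ (1 - 1 / p) := by
        refine (setLIntegral_riesz_far_le hp1 hfm hceq).trans ?_
        rw [hFx]
        gcongr
        exact h2 r hr
      calc L ^ 2 ≤ (F ^ (1 / p) * ENNReal.ofReal (C₂ * r ^ (n + c)) ^ (1 - 1 / p)) ^ 2 := by
            gcongr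
        _ = _ := by
          rw [← hr2, mul_pow]
          simp only [← ENNReal.rpow_natCast, ← ENNReal.rpow_mul]
          congr 2 <;> push_cast <;> ring
    have hSL : ∫⁻ z in ball (0 : EuclideanSpace ℝ (Fin n)) s,
        ENNReal.ofReal (‖z‖ ^ (1 - n : ℝ)) * ‖fderiv ℝ u (x + z)‖ₑ ≤ S + L := by
      rw [← lintegral_inter_add_sdiff _ (ball (0 : EuclideanSpace ℝ (Fin n)) s)
        (measurableSet_ball (x := 0) (ε := r))]
      exact add_le_add_right (lintegral_mono_set (sdiff_subset_compl _ _)) _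
    have hx : ‖u x‖ₑ ≤ ENNReal.ofReal C₀ * (A + (S + L)) :=
      (h0 u hu x s hs).trans (by gcongr)
    calc ‖u x‖ₑ ^ 2 ≤ (ENNReal.ofReal C₀ * (A + (S + L))) ^ 2 := by gcongr
      _ ≤ ENNReal.ofReal C₀ ^ 2 * (4 * (A ^ 2 + 4 * (S ^ 2 + L ^ 2))) := by
          rw [mul_pow]
          gcongr
          refine (ennreal_add_sq_le _ _).trans ?_
          gcongr
          exact ennreal_add_sq_le _ _
      _ ≤ ENNReal.ofReal C₀ ^ 2 * (4 * (4 * A ^ 2 + 4 * (S ^ 2 + L ^ 2))) := by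
          gcongr
          exact le_mul_of_one_le_left' (by norm_num)
      _ = ENNReal.ofReal (C₀ ^ 2 * 16) * (A ^ 2 + L ^ 2 + S ^ 2) := by
          rw [ENNReal.ofReal_mul (by positivity), ENNReal.ofReal_pow hC₀.le,
            ENNReal.ofReal_ofNat]
          ring
      _ ≤ _ := by gcongr
  have hQ : F ^ (2 / p - 1) * (ENNReal.ofReal D₁ * R₁) ≠ ∞ := by
    refine ENNReal.mul_ne_top (ENNReal.rpow_ne_top_of_nonneg ?_ hF)
      (ENNReal.mul_ne_top ENNReal.ofReal_ne_top ENNReal.ofReal_ne_top)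
    rw [sub_nonneg, le_div_iff₀ hp0]
    linarith
  have hJK : ∫⁻ x in K, J x * ρ x ≤ w * F := by
    refine setLIntegral_potential_mul_le (g := fun y => ‖fderiv ℝ u y‖ₑ ^ p)
      (hdc.measurable.enorm.pow_const p) hρ (fun y hy => ?_) hw
    rw [← ofReal_norm, huK y hy, norm_zero, ENNReal.ofReal_zero, ENNReal.zero_rpow_of_pos hp0]
  set P := A ^ 2 + F ^ (2 / p) * (ENNReal.ofReal D₂ * R₂)
  set Q := F ^ (2 / p - 1) * (ENNReal.ofReal D₁ * R₁)
  have hFF : F ^ (2 / p - 1) * F = F ^ (2 / p) := by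
    nth_rewrite 2 [← ENNReal.rpow_one F]
    rw [← ENNReal.rpow_add_of_nonneg _ _ _ zero_le_one, sub_add_cancel]
    rw [sub_nonneg, le_div_iff₀ hp0]
    linarith
  have hE : ∀ D : ℝ, D ≤ 1 + D₁ + D₂ → ENNReal.ofReal D ≤ ENNReal.ofReal (1 + D₁ + D₂) :=
    fun D hD => ENNReal.ofReal_le_ofReal hD
  have hE1 : 1 ≤ ENNReal.ofReal (1 + D₁ + D₂) := by
    simpa using hE 1 (by linarith)
  calc ∫⁻ x in K, ‖u x‖ₑ ^ 2 * ρ x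
      ≤ ∫⁻ x in K, ENNReal.ofReal (C₀ ^ 2 * 16) * (P * ρ x + Q * (J x * ρ x)) := by
        refine lintegral_mono fun x => (mul_le_mul_left (hpt x) _).trans_eq ?_
        ring
    _ = ENNReal.ofReal (C₀ ^ 2 * 16) * (P * (∫⁻ x in K, ρ x) + Q * ∫⁻ x in K, J x * ρ x) := by
        rw [lintegral_const_mul' _ _ ENNReal.ofReal_ne_top,
          lintegral_add_left (hρ.const_mul _), lintegral_const_mul _ hρ,
          lintegral_const_mul' _ _ hQ]
    _ ≤ ENNReal.ofReal (C₀ ^ 2 * 16) * (P * m + Q * (w * F)) := by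
        gcongr
        exact setLIntegral_le_lintegral _ _
    _ = ENNReal.ofReal (C₀ ^ 2 * 16) * (1 * (A ^ 2 * m) + F ^ (2 / p) *
          (ENNReal.ofReal D₁ * (R₁ * w) + ENNReal.ofReal D₂ * (R₂ * m))) := by
        simp only [P, Q]; rw [← hFF]; ring
    _ ≤ ENNReal.ofReal (C₀ ^ 2 * 16) * (ENNReal.ofReal (1 + D₁ + D₂) * (A ^ 2 * m) + F ^ (2 / p) *
          (ENNReal.ofReal (1 + D₁ + D₂) * (R₁ * w) +
            ENNReal.ofReal (1 + D₁ + D₂) * (R₂ * m))) := by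
        gcongr <;> linarith
    _ = _ := by
        rw [ENNReal.ofReal_mul (by positivity : (0 : ℝ) ≤ C₀ ^ 2 * 16)]; ring

lemma lintegral_enorm_rpow_eq_ofReal {X F : Type*} [TopologicalSpace X] [MeasurableSpace X]
    [OpensMeasurableSpace X] {μ : Measure X} [IsFiniteMeasureOnCompacts μ] [NormedAddCommGroup F]
    {f : X → F} (hf : Continuous f) (hfc : HasCompactSupport f) {K : Set X}
    (hfK : Function.support f ⊆ K) {q : ℝ} (hq : 0 < q) :
    ∫⁻ x, ‖f x‖ₑ ^ q ∂μ = ENNReal.ofReal (∫ x in K, ‖f x‖ ^ q ∂μ) := by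
  have hz : ∀ x, f x = 0 → ‖f x‖ ^ q = 0 := fun x hx => by
    rw [hx, norm_zero, Real.zero_rpow hq.ne']
  have hcont : Continuous fun x => ‖f x‖ ^ q := hf.norm.rpow_const fun _ => Or.inr hq.le
  have hcs : HasCompactSupport fun x => ‖f x‖ ^ q :=
    hfc.mono fun x hx h => hx (hz x h)
  rw [setIntegral_eq_integral_of_forall_compl_eq_zero
      (fun x hx => hz x (Function.notMem_support.1 fun h => hx (hfK h))),
    ofReal_integral_eq_lintegral_ofReal (hcont.integrable_of_hasCompactSupport hcs)
      (ae_of_all _ fun x => by positivity)]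
  refine lintegral_congr fun x => ?_
  rw [← ofReal_norm, ENNReal.ofReal_rpow_of_nonneg (norm_nonneg _) hq.le]

lemma sq_integral_norm_le {X : Type*} [MeasurableSpace X] {μ : Measure X} [IsFiniteMeasure μ]
    {f : X → ℝ} {p : ℝ} (hp : p ∈ Ioo (1 : ℝ) 2) (hf : MemLp f (ENNReal.ofReal p) μ) :
    (∫ x, |f x| ∂μ) ^ 2 ≤ (1 + μ.real univ ^ (2 * (p - 1))) *
      ((∫ x, |f x| ^ p ∂μ) ^ 2 + (∫ x, |f x| ∂μ) ^ (2 / p)) := by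
  have hp0 : 0 < p := by linarith [hp.1]
  have hp1 : 0 < p - 1 := by linarith [hp.1]
  set I := ∫ x, |f x| ∂μ
  set Y := ∫ x, |f x| ^ p ∂μ
  set V := μ.real univ
  have hI : 0 ≤ I := integral_nonneg fun _ => abs_nonneg _
  have hY : 0 ≤ Y := integral_nonneg fun _ => by positivity
  have hV : 0 ≤ V := measureReal_nonneg
  have hVp : 0 ≤ V ^ (2 * (p - 1)) := by positivity
  have hIp : 0 ≤ I ^ (2 / p) := by positivity
  rcases le_total I 1 with h1 | h1
  · have : I ^ 2 ≤ I ^ (2 / p) := by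
      rw [← Real.rpow_natCast]
      refine Real.rpow_le_rpow_of_exponent_ge' hI h1 (by positivity) ?_
      rw [div_le_iff₀ hp0]
      push_cast
      linarith [hp.1]
    nlinarith [mul_nonneg hVp hIp, mul_nonneg hVp (sq_nonneg Y)]
  · have hol : I ≤ Y ^ (1 / p) * V ^ (1 / (p / (p - 1))) := by
      have := integral_mul_le_Lp_mul_Lq_of_nonneg (μ := μ) (f := fun x => |f x|)
        (g := fun _ => (1 : ℝ)) (Real.HolderConjugate.conjExponent hp.1)
        (ae_of_all _ fun _ => abs_nonneg _) (ae_of_all _ fun _ => zero_le_one) hf.norm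
        (memLp_const 1)
      simpa [Real.conjExponent] using this
    have hpow : I ^ 2 ≤ Y ^ 2 * V ^ (2 * (p - 1)) := by
      calc I ^ 2 = I ^ (2 : ℝ) := by norm_cast
        _ ≤ I ^ (2 * p) := Real.rpow_le_rpow_of_exponent_le h1 (by linarith [hp.1])
        _ ≤ (Y ^ (1 / p) * V ^ (1 / (p / (p - 1)))) ^ (2 * p) := by gcongr
        _ = _ := by
          rw [Real.mul_rpow (by positivity) (by positivity), ← Real.rpow_mul hY,
            ← Real.rpow_mul hV, ← Real.rpow_natCast Y 2]
          congr 2 <;> (push_cast; field_simp)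
    nlinarith [mul_nonneg hVp hIp, mul_nonneg hVp (sq_nonneg Y)]

lemma exists_setIntegral_sq_mul_le_of_pos {n : ℕ} (hn : 2 ≤ n) {p : ℝ} (hp : p ∈ Ioo (1 : ℝ) 2)
    {M : ℝ} (hM : 0 < M) :
    ∃ C : ℝ, 0 < C ∧ ∀ K : Set (EuclideanSpace ℝ (Fin n)), IsCompact K →
      ∀ ρ : EuclideanSpace ℝ (Fin n) → ℝ, Measurable ρ → (∀ y, 0 ≤ ρ y) → Integrable ρ →
      ∫ y, ρ y ≤ M → ∀ s W : ℝ, 0 < s → 0 < W →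
      (∀ x ∈ K, ∫⁻ y in closedBall x s,
        ENNReal.ofReal (dist x y ^ ((p - n) / (p - 1)) * ρ y) ≤ ENNReal.ofReal W) →
      ∀ u : EuclideanSpace ℝ (Fin n) → ℝ, ContDiff ℝ 1 u → HasCompactSupport u →
      tsupport u ⊆ K →
      ∫ x in K, u x ^ 2 * ρ x ≤ C * (W ^ (2 * (p - 1) / p) *
        (∫ x in K, ‖fderiv ℝ u x‖ ^ p) ^ (2 / p) +
        ((s ^ n)⁻¹ * ∫ x in K, |u x|) ^ 2) := by
  have hp0 : 0 < p := by linarith [hp.1]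
  have hp1 : 0 < p - 1 := by linarith [hp.1]
  have he0 : (p - n) / (p - 1) ≠ 0 := by
    have : (2 : ℝ) ≤ n := by exact_mod_cast hn
    exact (div_neg_of_neg_of_pos (by linarith [hp.2]) hp1).ne
  obtain ⟨C, hC, hmain⟩ := exists_setLIntegral_sq_mul_le hn hp
  set N := M ^ ((2 - p) / p) with hN
  have hN0 : 0 < N := by positivity
  refine ⟨C * (M + 2 * N), by positivity,
    fun K hK ρ hρ hρ0 hρi hρM s W hs hW hWK u hu huc huK => ?_⟩
  set X := ∫ x in K, |u x|
  set G := ∫ x in K, ‖fderiv ℝ u x‖ ^ p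
  have hX : 0 ≤ X := integral_nonneg fun _ => abs_nonneg _
  have hG : 0 ≤ G := integral_nonneg fun _ => by positivity
  have hdc : Continuous (fderiv ℝ u) := hu.continuous_fderiv one_ne_zero
  have hdK : Function.support (fderiv ℝ u) ⊆ K := (support_fderiv_subset ℝ).trans huK
  have hXe : ∫⁻ x, ‖u x‖ₑ = ENNReal.ofReal X := by
    simpa using lintegral_enorm_rpow_eq_ofReal (μ := volume) hu.continuous huc
      ((subset_tsupport u).trans huK) one_pos
  have hGe : ∫⁻ x, ‖fderiv ℝ u x‖ₑ ^ p = ENNReal.ofReal G :=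
    lintegral_enorm_rpow_eq_ofReal hdc (huc.fderiv (𝕜 := ℝ)) hdK hp0
  have hme : ∫⁻ x, ENNReal.ofReal (ρ x) ≤ ENNReal.ofReal M := by
    rw [← ofReal_integral_eq_lintegral_ofReal hρi (ae_of_all _ hρ0)]
    exact ENNReal.ofReal_le_ofReal hρM
  set e := (p - n) / (p - 1)
  set r := (W / M) ^ (1 / e)
  have hre : r ^ e = W / M := by
    rw [← Real.rpow_mul (by positivity), one_div_mul_cancel he0, Real.rpow_one]
  have hW1 : (W / M) ^ ((p - 2) / p) * W = N * W ^ (2 * (p - 1) / p) := by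
    rw [Real.div_rpow hW.le hM.le, hN, div_mul_eq_mul_div, ← Real.rpow_add_one hW.ne',
      div_eq_mul_inv, ← Real.rpow_neg hM.le, mul_comm]
    congr 2 <;> (field_simp; ring)
  have hW2 : (W / M) ^ (2 * (p - 1) / p) * M = N * W ^ (2 * (p - 1) / p) := by
    rw [Real.div_rpow hW.le hM.le, hN, div_mul_eq_mul_div, mul_div_assoc, mul_comm]
    congr 1
    nth_rewrite 1 [← Real.rpow_one M]
    rw [← Real.rpow_sub hM]
    congr 1
    field_simp; ring
  have key : ∫⁻ x in K, ‖u x‖ₑ ^ 2 * ENNReal.ofReal (ρ x) ≤ ENNReal.ofReal (C *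
      (((s ^ n)⁻¹ * X) ^ 2 * M + G ^ (2 / p) * (2 * (N * W ^ (2 * (p - 1) / p))))) := by
    refine (hmain u hu K (fun y hy => Function.notMem_support.1 fun h => hy (hdK h))
      (hGe ▸ ENNReal.ofReal_ne_top) _ hρ.ennreal_ofReal s r (ENNReal.ofReal W) hs (by positivity)
      fun x hx => ?_).trans ?_
    · simpa only [ENNReal.ofReal_mul (Real.rpow_nonneg dist_nonneg _)] using hWK x hx
    · rw [hXe, hGe, hre, two_mul (N * _)]
      nth_rewrite 1 [← hW1]
      rw [← hW2, ENNReal.ofReal_mul hC.le, ENNReal.ofReal_add (by positivity) (by positivity),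
        ENNReal.ofReal_mul (by positivity), ENNReal.ofReal_pow (by positivity),
        ENNReal.ofReal_mul (by positivity), ENNReal.ofReal_mul (by positivity),
        ENNReal.ofReal_add (by positivity) (by positivity), ENNReal.ofReal_mul (by positivity),
        ENNReal.ofReal_mul (by positivity), ENNReal.ofReal_rpow_of_nonneg hG (by positivity)]
      gcongr
  have hreal : ∫ x in K, u x ^ 2 * ρ x ≤ C *
      (((s ^ n)⁻¹ * X) ^ 2 * M + G ^ (2 / p) * (2 * (N * W ^ (2 * (p - 1) / p)))) := by
    rw [integral_eq_lintegral_of_nonneg_ae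
      (ae_of_all _ fun x => mul_nonneg (sq_nonneg _) (hρ0 x))
      ((hu.continuous.measurable.pow_const 2).mul hρ).aestronglyMeasurable]
    refine ENNReal.toReal_le_of_le_ofReal (by positivity) (le_trans (le_of_eq ?_) key)
    refine lintegral_congr fun x => ?_
    rw [ENNReal.ofReal_mul (sq_nonneg _), ← ofReal_norm, ← ENNReal.ofReal_pow (norm_nonneg _),
      Real.norm_eq_abs, sq_abs]
  refine hreal.trans ?_
  rw [mul_assoc C]
  gcongr
  have h1 : 0 ≤ N * ((s ^ n)⁻¹ * X) ^ 2 := by positivity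
  have h2 : 0 ≤ M * (W ^ (2 * (p - 1) / p) * G ^ (2 / p)) := by positivity
  nlinarith

end helpers

/-- Weighted Sobolev embedding `W^{1,p}_0(K) ↪ L²(ρ dx)`: for `n ≥ 2`,
`p ∈ (1,2)`, `K ⊆ ℝⁿ` compact and `M > 0` there is `c₀ = c₀(n,p,K,M)` such that, for every
nonnegative `ρ ∈ L¹(ℝⁿ)` of mass at most `M`, every `s ∈ (0,1]`, every bound `W` for the
truncated potential `ω_p(s) = sup_{x ∈ K} ∫_{|x-y|≤s} |x-y|^{(p-n)/(p-1)} ρ(y) dy`, and every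
smooth `u` supported in `K`,
`∫_K |u|² ρ ≤ c₀ (W^{2(p-1)/p} ‖∇u‖²_{L^p(K)} + (1+s^{-2n})² (‖u‖_{L^p(K)}^{2p} + ‖u‖_{L¹(K)}^{2/p}))`. -/
theorem stmt6 (n : ℕ) (hn : 2 ≤ n) (p : ℝ) (hp : p ∈ Set.Ioo (1 : ℝ) 2)
    (K : Set (EuclideanSpace ℝ (Fin n))) (hK : IsCompact K) (M : ℝ) (hM : 0 < M) :
    ∃ c₀ : ℝ, 0 < c₀ ∧
      ∀ ρ : EuclideanSpace ℝ (Fin n) → ℝ, Measurable ρ → (∀ y, 0 ≤ ρ y) →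
        Integrable ρ → (∫ y, ρ y) ≤ M →
        ∀ s : ℝ, s ∈ Set.Ioc (0 : ℝ) 1 →
        ∀ W : ℝ, 0 ≤ W →
          (∀ x ∈ K, (∫⁻ y in closedBall x s,
              ENNReal.ofReal (dist x y ^ ((p - (n : ℝ)) / (p - 1)) * ρ y)) ≤
            ENNReal.ofReal W) →
        ∀ u : EuclideanSpace ℝ (Fin n) → ℝ, ContDiff ℝ (⊤ : ℕ∞) u →
          HasCompactSupport u → tsupport u ⊆ K →
          ∫ x in K, u x ^ 2 * ρ x ≤
            c₀ * (W ^ (2 * (p - 1) / p) *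
                    (∫ x in K, ‖fderiv ℝ u x‖ ^ p) ^ ((2 : ℝ) / p) +
                  (1 + s ^ (-2 * (n : ℝ))) ^ 2 *
                    ((∫ x in K, |u x| ^ p) ^ 2 +
                     (∫ x in K, |u x|) ^ ((2 : ℝ) / p))) := by
  have hp0 : 0 < p := by linarith [hp.1]
  have hp1 : 0 < p - 1 := by linarith [hp.1]
  obtain ⟨C, hC, hbound⟩ := exists_setIntegral_sq_mul_le_of_pos hn hp hM
  set V := (volume.restrict K).real univ
  have hV : 0 ≤ V ^ (2 * (p - 1)) := Real.rpow_nonneg measureReal_nonneg _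
  refine ⟨C * (1 + V ^ (2 * (p - 1))), by positivity,
    fun ρ hρ hρ0 hρi hρM s hs W hW hWK u hu huc huK => ?_⟩
  have hs0 : 0 < s := hs.1
  have hu1 : ContDiff ℝ 1 u := hu.of_le (by exact_mod_cast le_top)
  set X := ∫ x in K, |u x|
  set Y := ∫ x in K, |u x| ^ p
  set G := ∫ x in K, ‖fderiv ℝ u x‖ ^ p
  have hlim : ∫ x in K, u x ^ 2 * ρ x ≤
      C * (W ^ (2 * (p - 1) / p) * G ^ (2 / p) + ((s ^ n)⁻¹ * X) ^ 2) := by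
    have hcont : Continuous fun W' : ℝ =>
        C * (W' ^ (2 * (p - 1) / p) * G ^ (2 / p) + ((s ^ n)⁻¹ * X) ^ 2) :=
      (((continuous_id.rpow_const fun _ => Or.inr (by positivity)).mul_const _).add_const
        _).const_mul _
    refine ge_of_tendsto ((hcont.tendsto W).mono_left (nhdsWithin_le_nhds (s := Ioi W))) ?_
    filter_upwards [self_mem_nhdsWithin] with W' hW'
    exact hbound K hK ρ hρ hρ0 hρi hρM s W' hs0 (hW.trans_lt hW')
      (fun x hx => (hWK x hx).trans (ENNReal.ofReal_le_ofReal (le_of_lt hW'))) u hu1 huc huK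
  have : IsFiniteMeasure (volume.restrict K) := isFiniteMeasure_restrict.2 hK.measure_ne_top
  have hXY : X ^ 2 ≤ (1 + V ^ (2 * (p - 1))) * (Y ^ 2 + X ^ (2 / p)) :=
    sq_integral_norm_le hp ((hu1.continuous.memLp_of_hasCompactSupport huc).restrict K)
  have hsn : ((s ^ n)⁻¹) ^ 2 ≤ (1 + s ^ (-2 * (n : ℝ))) ^ 2 := by
    have h1 : s ^ (-2 * (n : ℝ)) = ((s ^ n)⁻¹) ^ 2 := by
      rw [show -2 * (n : ℝ) = -((n * 2 : ℕ) : ℝ) by push_cast; ring, Real.rpow_neg hs0.le,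
        Real.rpow_natCast, pow_mul, inv_pow]
    have h2 : 0 ≤ ((s ^ n)⁻¹) ^ 2 := by positivity
    rw [h1]
    nlinarith
  refine hlim.trans ?_
  rw [mul_assoc C, mul_add (1 + V ^ _)]
  refine mul_le_mul_of_nonneg_left (add_le_add ?_ ?_) hC.le
  · exact le_mul_of_one_le_left (by positivity) (by linarith)
  · calc ((s ^ n)⁻¹ * X) ^ 2 = ((s ^ n)⁻¹) ^ 2 * X ^ 2 := mul_pow _ _ _
      _ ≤ (1 + s ^ (-2 * (n : ℝ))) ^ 2 *
          ((1 + V ^ (2 * (p - 1))) * (Y ^ 2 + X ^ (2 / p))) := by gcongr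
      _ = _ := by ring
end

section
/- Let n ≥ 2 be an integer, R, T > 0, δ ∈ (0,1), s > n with δ < 1 - n/s, and define τ by 1/τ = (n-1+δ)/(2n) + 1/(2s), so that τ > 2. Let a, b : B_R × (0,T) → [0,∞) be measurable and let Ω ⊂ B_R × (0,T) be measurable with t-sections Ω_t. Define F(x,t) = ∫_{B_R} |x-y|^{1-n} √(a(y,t) b(y,t)) dy. Then ( ∫_0^T ‖F(·,t)‖_{L^τ(Ω_t)}^{2s} dt )^{1/(2s)} ≤ C(n,δ,R) ( ess sup_{t∈(0,T)} ∫_{B_R} b(y,t) dy )^{1/2} ( ∫∫_Ω ( ∫_{B_R} |x-y|^{1-n} a(y,t) dy )^{s} dx dt )^{1/(2s)}. -/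
open MeasureTheory Metric Set Filter Topology ENNReal

lemma ofReal_integral_le_lintegral_ofReal {α : Type*} [MeasurableSpace α] {μ : Measure α}
    {f : α → ℝ} (hf : ∀ x, 0 ≤ f x) :
    ENNReal.ofReal (∫ x, f x ∂μ) ≤ ∫⁻ x, ENNReal.ofReal (f x) ∂μ := by
  by_cases h : Integrable f μ
  · exact (ofReal_integral_eq_lintegral_ofReal h (ae_of_all _ hf)).le
  · simp [integral_undef h]

/-- Uniform bound for the local `L^q` norms of the kernel `|x - y|^{1-n}`. -/
lemma exists_lintegral_dist_rpow_le {E : Type*} [NormedAddCommGroup E] [NormedSpace ℝ E]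
    [FiniteDimensional ℝ E] [MeasurableSpace E] [BorelSpace E] (μ : Measure E)
    [μ.IsAddHaarMeasure] (hd : 1 ≤ Module.finrank ℝ E) {β q : ℝ} (hq : 0 ≤ q)
    (hβ : -β * q < Module.finrank ℝ E) (R : ℝ) :
    ∃ K : ℝ≥0∞, K ≠ ∞ ∧ ∀ y ∈ closedBall (0 : E) R,
      ∫⁻ x in closedBall (0 : E) R, ENNReal.ofReal (dist x y ^ β) ^ q ∂μ ≤ K := by
  set r : ℝ := 2 * R + 1
  set g : E → ℝ≥0∞ := (ball (0 : E) r).indicator fun z => ENNReal.ofReal (‖z‖ ^ (β * q)) with hg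
  have hint : IntegrableOn (fun z : E => ‖z‖ ^ (β * q)) (ball 0 r) μ := by
    refine integrableOn_ball_of_norm_le_rpow (C := 1) (α := -β * q) hd hβ ?_ ?_
    · refine ae_of_all _ fun x => ?_
      rw [Real.norm_of_nonneg (by positivity), one_mul, neg_mul, neg_neg]
    · exact (measurable_norm.pow_const _).aestronglyMeasurable
  refine ⟨∫⁻ z, g z ∂μ, ?_, fun y hy => ?_⟩
  · rw [hg, lintegral_indicator measurableSet_ball]
    exact hint.lintegral_lt_top.ne
  · rw [← lintegral_indicator measurableSet_closedBall, ← lintegral_sub_right_eq_self g y]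
    refine lintegral_mono fun x => ?_
    by_cases hx : x ∈ closedBall (0 : E) R
    · have hxy : x - y ∈ ball (0 : E) r := by
        rw [mem_closedBall_zero_iff] at hx hy
        rw [mem_ball_zero_iff]
        linarith [norm_sub_le x y]
      rw [indicator_of_mem hx, hg, indicator_of_mem hxy, dist_eq_norm,
        ENNReal.ofReal_rpow_of_nonneg (by positivity) hq, ← Real.rpow_mul (norm_nonneg _)]
    · rw [indicator_of_notMem hx]
      exact zero_le

/-- An integral operator whose kernel has uniformly bounded `L^q` norms maps `L¹` to `L^q`. -/
lemma lintegral_rpow_lintegral_mul_le {X : Type*} [MeasurableSpace X] {μ : Measure X} [SFinite μ]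
    {k : X → X → ℝ≥0∞} (hk : Measurable (Function.uncurry k)) {B : X → ℝ≥0∞} (hB : Measurable B)
    {q : ℝ} (hq : 1 ≤ q) {K : ℝ≥0∞} (hK : ∀ᵐ y ∂μ, ∫⁻ x, k x y ^ q ∂μ ≤ K) :
    ∫⁻ x, (∫⁻ y, k x y * B y ∂μ) ^ q ∂μ ≤ K * (∫⁻ y, B y ∂μ) ^ q := by
  have hq0 : 0 < q := by linarith
  have hq1 : 0 ≤ 1 - q⁻¹ := sub_nonneg.2 (inv_le_one_of_one_le₀ hq)
  have hkx : ∀ x, Measurable (k x) := fun x => hk.comp measurable_prodMk_left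
  have pointwise : ∀ x, (∫⁻ y, k x y * B y ∂μ) ^ q ≤
      (∫⁻ y, k x y ^ q * B y ∂μ) * (∫⁻ y, B y ∂μ) ^ (q - 1) := by
    intro x
    have hsplit : ∀ y, k x y * B y = (k x y ^ q * B y) ^ q⁻¹ * B y ^ (1 - q⁻¹) := by
      intro y
      rw [ENNReal.mul_rpow_of_nonneg _ _ (by positivity), ENNReal.rpow_rpow_inv hq0.ne', mul_assoc,
        ← ENNReal.rpow_add_of_nonneg _ _ (by positivity) hq1, add_sub_cancel, ENNReal.rpow_one]
    calc (∫⁻ y, k x y * B y ∂μ) ^ q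
        = (∫⁻ y, (k x y ^ q * B y) ^ q⁻¹ * B y ^ (1 - q⁻¹) ∂μ) ^ q := by simp_rw [← hsplit]
      _ ≤ ((∫⁻ y, k x y ^ q * B y ∂μ) ^ q⁻¹ * (∫⁻ y, B y ∂μ) ^ (1 - q⁻¹)) ^ q := by
        gcongr
        exact ENNReal.lintegral_mul_norm_pow_le (((hkx x).pow_const q).mul hB).aemeasurable
          hB.aemeasurable (by positivity) hq1 (by ring)
      _ = _ := by
        rw [ENNReal.mul_rpow_of_nonneg _ _ hq0.le, ENNReal.rpow_inv_rpow hq0.ne',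
          ← ENNReal.rpow_mul]
        congr 2
        field_simp
  have hkB : Measurable (Function.uncurry fun x y => k x y ^ q * B y) :=
    (hk.pow_const q).mul (hB.comp measurable_snd)
  calc ∫⁻ x, (∫⁻ y, k x y * B y ∂μ) ^ q ∂μ
      ≤ ∫⁻ x, (∫⁻ y, k x y ^ q * B y ∂μ) * (∫⁻ y, B y ∂μ) ^ (q - 1) ∂μ := lintegral_mono pointwise
    _ = (∫⁻ y, (∫⁻ x, k x y ^ q ∂μ) * B y ∂μ) * (∫⁻ y, B y ∂μ) ^ (q - 1) := by
      rw [lintegral_mul_const _ hkB.lintegral_prod_right, lintegral_lintegral_swap hkB.aemeasurable]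
      congr 2 with y
      exact lintegral_mul_const _ ((hk.comp measurable_prodMk_right).pow_const q)
    _ ≤ (∫⁻ y, K * B y ∂μ) * (∫⁻ y, B y ∂μ) ^ (q - 1) := by
      gcongr ?_ * _
      refine lintegral_mono_ae (hK.mono fun y hy => ?_)
      gcongr
    _ = K * (∫⁻ y, B y ∂μ) ^ q := by
      rw [lintegral_const_mul _ hB, mul_assoc]
      congr 1
      nth_rewrite 1 [← ENNReal.rpow_one (∫⁻ y, B y ∂μ)]
      rw [← ENNReal.rpow_add_of_nonneg _ _ zero_le_one (by linarith), add_sub_cancel]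

/-- Estimate for `∫ k(x,y) √(A B) dy` in `L^τ`, by Cauchy–Schwarz in `y` and Hölder in `x`. -/
lemma lintegral_rpow_lintegral_kernel_sqrt_le {X : Type*} [MeasurableSpace X] {μ ν : Measure X}
    [SFinite μ] (hν : ν ≤ μ)
    {k : X → X → ℝ≥0∞} (hk : Measurable (Function.uncurry k)) {A B : X → ℝ≥0∞}
    (hA : Measurable A) (hB : Measurable B) {q s τ : ℝ} (hq : 1 ≤ q) (hs : 0 < s) (hτ : 0 < τ)
    (hτqs : 1 / τ = 1 / (2 * q) + 1 / (2 * s))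
    {K : ℝ≥0∞} (hK : ∀ᵐ y ∂μ, ∫⁻ x, k x y ^ q ∂μ ≤ K) :
    (∫⁻ x, (∫⁻ y, k x y * (A y * B y) ^ (1 / 2 : ℝ) ∂μ) ^ τ ∂ν) ^ (2 * s / τ) ≤
      (∫⁻ x, (∫⁻ y, k x y * A y ∂μ) ^ s ∂ν) * (K ^ (1 / q) * ∫⁻ y, B y ∂μ) ^ s := by
  have hq0 : 0 < q := by linarith
  have hkx : ∀ x, Measurable (k x) := fun x => hk.comp measurable_prodMk_left
  set G : X → ℝ≥0∞ := fun x => ∫⁻ y, k x y * A y ∂μ with hG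
  set H : X → ℝ≥0∞ := fun x => ∫⁻ y, k x y * B y ∂μ with hH
  have hGm : Measurable G :=
    Measurable.lintegral_prod_right (f := fun x y => k x y * A y)
      (hk.mul (hA.comp measurable_snd))
  have hHm : Measurable H :=
    Measurable.lintegral_prod_right (f := fun x y => k x y * B y)
      (hk.mul (hB.comp measurable_snd))
  have pointwise : ∀ x, (∫⁻ y, k x y * (A y * B y) ^ (1 / 2 : ℝ) ∂μ) ^ τ ≤
      (G x ^ s) ^ (τ / (2 * s)) * (H x ^ q) ^ (τ / (2 * q)) := by
    intro x
    have hsplit : ∀ y, k x y * (A y * B y) ^ (1 / 2 : ℝ) =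
        (k x y * A y) ^ (1 / 2 : ℝ) * (k x y * B y) ^ (1 / 2 : ℝ) := by
      intro y
      have h2 : k x y = k x y ^ (1 / 2 : ℝ) * k x y ^ (1 / 2 : ℝ) := by
        rw [← ENNReal.rpow_add_of_nonneg _ _ (by norm_num) (by norm_num)]
        norm_num
      nth_rewrite 1 [h2]
      simp_rw [ENNReal.mul_rpow_of_nonneg _ _ (show (0 : ℝ) ≤ 1 / 2 by norm_num)]
      ring
    calc (∫⁻ y, k x y * (A y * B y) ^ (1 / 2 : ℝ) ∂μ) ^ τ
        = (∫⁻ y, (k x y * A y) ^ (1 / 2 : ℝ) * (k x y * B y) ^ (1 / 2 : ℝ) ∂μ) ^ τ := by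
          simp_rw [hsplit]
      _ ≤ (G x ^ (1 / 2 : ℝ) * H x ^ (1 / 2 : ℝ)) ^ τ := by
          gcongr
          exact ENNReal.lintegral_mul_norm_pow_le ((hkx x).mul hA).aemeasurable
            ((hkx x).mul hB).aemeasurable (by norm_num) (by norm_num) (by norm_num)
      _ = _ := by
          rw [ENNReal.mul_rpow_of_nonneg _ _ hτ.le]
          simp_rw [← ENNReal.rpow_mul]
          congr 2 <;> field_simp
  have hsum : τ / (2 * s) + τ / (2 * q) = 1 := by
    have : τ / (2 * s) + τ / (2 * q) = τ * (1 / (2 * q) + 1 / (2 * s)) := by ring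
    rw [this, ← hτqs, mul_one_div_cancel hτ.ne']
  calc (∫⁻ x, (∫⁻ y, k x y * (A y * B y) ^ (1 / 2 : ℝ) ∂μ) ^ τ ∂ν) ^ (2 * s / τ)
      ≤ (∫⁻ x, (G x ^ s) ^ (τ / (2 * s)) * (H x ^ q) ^ (τ / (2 * q)) ∂ν) ^ (2 * s / τ) := by
        gcongr with x
        exact pointwise x
    _ ≤ ((∫⁻ x, G x ^ s ∂ν) ^ (τ / (2 * s)) * (∫⁻ x, H x ^ q ∂ν) ^ (τ / (2 * q))) ^
          (2 * s / τ) := by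
        gcongr
        exact ENNReal.lintegral_mul_norm_pow_le (hGm.pow_const s).aemeasurable
          (hHm.pow_const q).aemeasurable (by positivity) (by positivity) hsum
    _ ≤ ((∫⁻ x, G x ^ s ∂ν) ^ (τ / (2 * s)) * (K * (∫⁻ y, B y ∂μ) ^ q) ^ (τ / (2 * q))) ^
          (2 * s / τ) := by
        gcongr
        exact (lintegral_mono' hν le_rfl).trans (lintegral_rpow_lintegral_mul_le hk hB hq hK)
    _ = _ := by
        rw [ENNReal.mul_rpow_of_nonneg _ _ (by positivity), ← ENNReal.rpow_mul,
          ← ENNReal.rpow_mul, ENNReal.mul_rpow_of_nonneg _ _ (by positivity),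
          ENNReal.mul_rpow_of_nonneg _ _ hs.le, ← ENNReal.rpow_mul, ← ENNReal.rpow_mul]
        have h1 : τ / (2 * s) * (2 * s / τ) = 1 := by field_simp
        have h2 : τ / (2 * q) * (2 * s / τ) = 1 / q * s := by field_simp
        have h3 : q * (1 / q * s) = s := by field_simp
        rw [h1, h2, h3, ENNReal.rpow_one]

/-- Mixed space-time potential estimate (Lemma 5.1 of the paper): for
`n ≥ 2`, `δ ∈ (0,1)`, `R > 0` there is `C = C(n,δ,R)` such that for all `T > 0`, `s > n`
with `δ < 1 - n/s` and `τ` defined by `1/τ = (n-1+δ)/(2n) + 1/(2s)` (so `τ > 2`), all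
nonnegative measurable `a, b` on `B_R × (0,T)` and every measurable
`Ω ⊆ B_R × (0,T)` with `t`-sections `Ω_t`, the potential
`F(x,t) = ∫_{B_R} |x-y|^{1-n} √(a b) dy` satisfies
`(∫_0^T ‖F(⋅,t)‖_{L^τ(Ω_t)}^{2s} dt)^{1/(2s)} ≤ C (esssup_t ∫_{B_R} b)^{1/2}
(∫∫_Ω (∫_{B_R} |x-y|^{1-n} a dy)^s)^{1/(2s)}`. -/
theorem stmt15 (n : ℕ) (hn : 2 ≤ n) (δ R : ℝ)
    (hδ : δ ∈ Set.Ioo (0 : ℝ) 1) (hR : 0 < R) :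
    ∃ C : ℝ, 0 < C ∧
      ∀ T : ℝ, 0 < T → ∀ s : ℝ, (n : ℝ) < s → δ < 1 - (n : ℝ) / s →
        let τ : ℝ := (((n : ℝ) - 1 + δ) / (2 * (n : ℝ)) + 1 / (2 * s))⁻¹
        2 < τ ∧
        ∀ a b : EuclideanSpace ℝ (Fin n) → ℝ → ℝ,
          Measurable (Function.uncurry a) → Measurable (Function.uncurry b) →
          (∀ y t, 0 ≤ a y t) → (∀ y t, 0 ≤ b y t) →
          ∀ Ω : Set (EuclideanSpace ℝ (Fin n) × ℝ), MeasurableSet Ω →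
            Ω ⊆ (closedBall (0 : EuclideanSpace ℝ (Fin n)) R) ×ˢ Set.Ioo (0 : ℝ) T →
            ENNReal.ofReal
                ((∫ t in Set.Ioo (0 : ℝ) T,
                    ((∫ x in {x : EuclideanSpace ℝ (Fin n) | (x, t) ∈ Ω},
                        (∫ y in closedBall (0 : EuclideanSpace ℝ (Fin n)) R,
                          dist x y ^ (1 - (n : ℝ)) *
                            Real.sqrt (a y t * b y t)) ^ τ) ^ (1 / τ)) ^ (2 * s)) ^
                  (1 / (2 * s))) ≤
              ENNReal.ofReal C *
                (essSup
                    (fun t => ∫⁻ y in closedBall (0 : EuclideanSpace ℝ (Fin n)) R,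
                      ENNReal.ofReal (b y t))
                    (volume.restrict (Set.Ioo (0 : ℝ) T))) ^ ((1 : ℝ) / 2) *
                (∫⁻ q in Ω,
                    (∫⁻ y in closedBall (0 : EuclideanSpace ℝ (Fin n)) R,
                      ENNReal.ofReal (dist q.1 y ^ (1 - (n : ℝ)) * a y q.2)) ^ s) ^
                  (1 / (2 * s)) := by
  obtain ⟨hδ0, hδ1⟩ := hδ
  have hn2 : (2 : ℝ) ≤ n := by exact_mod_cast hn
  have hn0 : (0 : ℝ) < n := by linarith
  have hden : 0 < (n : ℝ) - 1 + δ := by linarith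
  set q : ℝ := n / (n - 1 + δ) with hqdef
  have hq1 : 1 ≤ q := by
    rw [hqdef, le_div_iff₀ hden]
    linarith
  have hq0 : 0 < q := by linarith
  have hfin : Module.finrank ℝ (EuclideanSpace ℝ (Fin n)) = n := finrank_euclideanSpace_fin
  obtain ⟨K, hKtop, hK⟩ := exists_lintegral_dist_rpow_le
    (volume : Measure (EuclideanSpace ℝ (Fin n))) (by omega) (β := 1 - (n : ℝ)) hq0.le
    (by
      rw [hfin, hqdef, ← mul_div_assoc, div_lt_iff₀ hden]
      nlinarith) R
  set L : ℝ≥0∞ := K ^ (1 / q) with hL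
  have hLtop : L ^ (1 / 2 : ℝ) ≠ ∞ :=
    ENNReal.rpow_ne_top_of_nonneg (by norm_num) (ENNReal.rpow_ne_top_of_nonneg (by positivity) hKtop)
  refine ⟨(L ^ (1 / 2 : ℝ)).toReal + 1, by positivity, ?_⟩
  intro T hT s hns hδs
  have hs : 0 < s := by linarith
  have hτpos : 0 < ((n : ℝ) - 1 + δ) / (2 * n) + 1 / (2 * s) := by positivity
  have hτlt : ((n : ℝ) - 1 + δ) / (2 * n) + 1 / (2 * s) < 2⁻¹ := by
    have h : ((n : ℝ) - 1 + δ) / (2 * n) + 1 / (2 * s) =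
        2⁻¹ + (δ - (1 - n / s)) / (2 * n) := by
      field_simp
      ring
    rw [h]
    have : (δ - (1 - n / s)) / (2 * n) < 0 := div_neg_of_neg_of_pos (by linarith) (by linarith)
    linarith
  intro τ
  have hτ2 : 2 < τ := (lt_inv_comm₀ two_pos hτpos).2 hτlt
  have hτ0 : 0 < τ := by linarith
  have hτqs : 1 / τ = 1 / (2 * q) + 1 / (2 * s) := by
    simp only [τ, one_div, inv_inv, hqdef]
    congr 1
    field_simp
  refine ⟨hτ2, ?_⟩
  intro a b ha hb ha0 hb0 Ω hΩ hΩsub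
  set S := closedBall (0 : EuclideanSpace ℝ (Fin n)) R with hS
  set μ := (volume : Measure (EuclideanSpace ℝ (Fin n))).restrict S with hμ
  set k : EuclideanSpace ℝ (Fin n) → EuclideanSpace ℝ (Fin n) → ℝ≥0∞ :=
    fun x y => ENNReal.ofReal (dist x y ^ (1 - (n : ℝ))) with hk
  have hkm : Measurable (Function.uncurry k) := by
    refine Measurable.ennreal_ofReal ?_
    exact (measurable_fst.dist measurable_snd).pow_const _
  have hKae : ∀ᵐ y ∂μ, ∫⁻ x, k x y ^ q ∂μ ≤ K :=
    (ae_restrict_mem measurableSet_closedBall).mono hK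
  set M : ℝ≥0∞ := essSup (fun t => ∫⁻ y, ENNReal.ofReal (b y t) ∂μ)
    (volume.restrict (Ioo (0 : ℝ) T)) with hM
  have hMae := ENNReal.ae_le_essSup (μ := volume.restrict (Ioo (0 : ℝ) T))
    fun t => ∫⁻ y, ENNReal.ofReal (b y t) ∂μ
  have hkernel : ∀ x y t, ENNReal.ofReal (dist x y ^ (1 - (n : ℝ)) * a y t) =
      k x y * ENNReal.ofReal (a y t) :=
    fun x y t => ENNReal.ofReal_mul (by positivity)
  simp_rw [hkernel]
  set G : EuclideanSpace ℝ (Fin n) × ℝ → ℝ≥0∞ :=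
    fun p => (∫⁻ y, k p.1 y * ENNReal.ofReal (a y p.2) ∂μ) ^ s with hG
  have hGm : Measurable G := by
    refine Measurable.pow_const ?_ s
    refine Measurable.lintegral_prod_right
      (f := fun (p : EuclideanSpace ℝ (Fin n) × ℝ) y => k p.1 y * ENNReal.ofReal (a y p.2)) ?_
    exact (hkm.comp ((measurable_fst.comp measurable_fst).prodMk measurable_snd)).mul
      (ha.comp (measurable_snd.prodMk (measurable_snd.comp measurable_fst))).ennreal_ofReal
  have hsec : ∀ t, MeasurableSet {x : EuclideanSpace ℝ (Fin n) | (x, t) ∈ Ω} :=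
    fun t => measurable_prodMk_right hΩ
  have hslice : ∀ t, ENNReal.ofReal (((∫ x in {x : EuclideanSpace ℝ (Fin n) | (x, t) ∈ Ω},
      (∫ y in S, dist x y ^ (1 - (n : ℝ)) * Real.sqrt (a y t * b y t)) ^ τ) ^ (1 / τ)) ^ (2 * s)) ≤
      (∫⁻ x in {x : EuclideanSpace ℝ (Fin n) | (x, t) ∈ Ω}, G (x, t)) *
        (L * ∫⁻ y, ENNReal.ofReal (b y t) ∂μ) ^ s := by
    intro t
    have hF0 : ∀ x, 0 ≤ ∫ y in S, dist x y ^ (1 - (n : ℝ)) * Real.sqrt (a y t * b y t) :=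
      fun x => integral_nonneg fun y => by positivity
    have hI0 : 0 ≤ ∫ x in {x : EuclideanSpace ℝ (Fin n) | (x, t) ∈ Ω},
        (∫ y in S, dist x y ^ (1 - (n : ℝ)) * Real.sqrt (a y t * b y t)) ^ τ :=
      integral_nonneg fun x => Real.rpow_nonneg (hF0 x) _
    have hν : volume.restrict {x : EuclideanSpace ℝ (Fin n) | (x, t) ∈ Ω} ≤ μ :=
      Measure.restrict_mono
        (show {x : EuclideanSpace ℝ (Fin n) | (x, t) ∈ Ω} ⊆ S from fun x hx => (hΩsub hx).1) le_rfl
    refine le_trans ?_ (lintegral_rpow_lintegral_kernel_sqrt_le hν hkm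
      (A := fun y => ENNReal.ofReal (a y t)) (B := fun y => ENNReal.ofReal (b y t))
      (ha.comp measurable_prodMk_right).ennreal_ofReal
      (hb.comp measurable_prodMk_right).ennreal_ofReal hq1 hs hτ0 hτqs hKae)
    rw [← Real.rpow_mul hI0, one_div_mul_eq_div,
      ← ENNReal.ofReal_rpow_of_nonneg hI0 (by positivity)]
    gcongr
    refine (ofReal_integral_le_lintegral_ofReal fun x => Real.rpow_nonneg (hF0 x) _).trans ?_
    refine lintegral_mono fun x => ?_
    rw [← ENNReal.ofReal_rpow_of_nonneg (hF0 x) hτ0.le]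
    gcongr
    refine (ofReal_integral_le_lintegral_ofReal fun y => by positivity).trans ?_
    refine lintegral_mono fun y => le_of_eq ?_
    rw [ENNReal.ofReal_mul (by positivity), Real.sqrt_eq_rpow, ← ENNReal.ofReal_mul (ha0 y t),
      ENNReal.ofReal_rpow_of_nonneg (mul_nonneg (ha0 y t) (hb0 y t)) (by norm_num)]
  have hind : ∀ t, ∫⁻ x in {x : EuclideanSpace ℝ (Fin n) | (x, t) ∈ Ω}, G (x, t) =
      ∫⁻ x, Ω.indicator G (x, t) := by
    intro t
    rw [← lintegral_indicator (hsec t)]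
    rfl
  have hindm : Measurable (Ω.indicator G) := hGm.indicator hΩ
  have htime : ∫⁻ t in Ioo (0 : ℝ) T, ∫⁻ x, Ω.indicator G (x, t) ≤ ∫⁻ p in Ω, G p := by
    rw [← lintegral_indicator hΩ, Measure.volume_eq_prod, lintegral_prod_symm' _ hindm]
    exact setLIntegral_le_lintegral _ _
  rw [← ENNReal.ofReal_rpow_of_nonneg
    (integral_nonneg fun t => Real.rpow_nonneg (Real.rpow_nonneg (integral_nonneg fun x =>
      Real.rpow_nonneg (integral_nonneg fun y => by positivity) _) _) _) (by positivity)]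
  calc _ ≤ ((∫⁻ p in Ω, G p) * (L * M) ^ s) ^ (1 / (2 * s)) := by
        gcongr
        refine (ofReal_integral_le_lintegral_ofReal fun t =>
          Real.rpow_nonneg (Real.rpow_nonneg (integral_nonneg fun x =>
            Real.rpow_nonneg (integral_nonneg fun y => by positivity) _) _) _).trans ?_
        calc _ ≤ ∫⁻ t in Ioo (0 : ℝ) T, (∫⁻ x, Ω.indicator G (x, t)) * (L * M) ^ s := by
              refine lintegral_mono_ae (hMae.mono fun t ht => (hslice t).trans ?_)
              rw [hind]
              gcongr
          _ = (∫⁻ t in Ioo (0 : ℝ) T, ∫⁻ x, Ω.indicator G (x, t)) * (L * M) ^ s :=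
              lintegral_mul_const _ hindm.lintegral_prod_left'
          _ ≤ _ := by gcongr
    _ = L ^ (1 / 2 : ℝ) * M ^ (1 / 2 : ℝ) * (∫⁻ p in Ω, G p) ^ (1 / (2 * s)) := by
        rw [ENNReal.mul_rpow_of_nonneg _ _ (by positivity), ← ENNReal.rpow_mul,
          show s * (1 / (2 * s)) = 1 / 2 by field_simp,
          ENNReal.mul_rpow_of_nonneg _ _ (by norm_num), mul_comm]
    _ ≤ _ := by
        gcongr
        exact (ENNReal.ofReal_toReal hLtop).symm.le.trans
          (ENNReal.ofReal_le_ofReal (by linarith))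
end
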